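/- Let n ≥ 1 be odd and let P = (ξ_1 − ξ_2)(ξ_2 − ξ_3)⋯(ξ_{n−1} − ξ_n) ∈ 𝒞_n. The trace of the ℂ-linear endomorphism of the left ideal L_n = 𝒞_n·e induced by left multiplication by P equals (−1)^{(n−1)/2}·2^{(n+1)/2}. -/

import Mathlib

namespace CliffordSpin

open CliffordAlgebra

/-- The quadratic form `Q(x) = x₁² + ⋯ + xₙ²` on `ℂⁿ`. -/
noncomputable def Qf (n : ℕ) : QuadraticForm ℂ (Fin n → ℂ) :=
  QuadraticMap.weightedSumSquares ℂ (fun _ : Fin n => (1 : ℂ))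

/-- The Clifford algebra `𝒞ₙ`. -/
abbrev Cl (n : ℕ) := CliffordAlgebra (Qf n)

/-- The generators `ξᵢ` of `𝒞ₙ` (images of the standard basis vectors). -/
noncomputable def ξ (n : ℕ) (i : Fin n) : Cl n := CliffordAlgebra.ι (Qf n) (Pi.single i 1)

/-- The idempotents `eᵢ = (1/2)(1 + √−1 ξ_{2i−1} ξ_{2i})` and their product
`e = e₁ ⋯ e_r`, `r = ⌊n/2⌋` (indices are 0-based here). -/
noncomputable def eIdem (n : ℕ) : Cl n :=
  ((List.finRange (n / 2)).map fun i : Fin (n / 2) =>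
      (2 : ℂ)⁻¹ • (1 + Complex.I •
        (ξ n ⟨2 * (i : ℕ), by have := i.isLt; omega⟩ *
         ξ n ⟨2 * (i : ℕ) + 1, by have := i.isLt; omega⟩))).prod

/-- The left ideal `Lₙ = 𝒞ₙ·e`, as a ℂ-subspace of `𝒞ₙ`. -/
noncomputable def Ln (n : ℕ) : Submodule ℂ (Cl n) := LinearMap.range (LinearMap.mulRight ℂ (eIdem n))


/-- `P = (ξ₁ − ξ₂)(ξ₂ − ξ₃) ⋯ (ξ_{n−1} − ξₙ)` (0-based indexing). -/
noncomputable def Pelt (n : ℕ) : Cl n :=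
  ((List.finRange (n - 1)).map fun i : Fin (n - 1) =>
      ξ n ⟨(i : ℕ), by have := i.isLt; omega⟩ -
      ξ n ⟨(i : ℕ) + 1, by have := i.isLt; omega⟩).prod

/-- Left multiplication by `P` preserves the left ideal `Lₙ`. -/
theorem mulLeft_mem_Ln (n : ℕ) (P : Cl n) : ∀ x ∈ Ln n, P * x ∈ Ln n := by
  rintro x ⟨y, rfl⟩
  exact ⟨P * y, by simp [LinearMap.mulRight_apply, mul_assoc]⟩

/-- The endomorphism of `Lₙ` induced by left multiplication by `P`. -/
noncomputable def lmulLn (n : ℕ) (P : Cl n) : Ln n →ₗ[ℂ] Ln n :=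
  (LinearMap.mulLeft ℂ P).restrict (fun x hx => mulLeft_mem_Ln n P x hx)

section TraceForms

variable {A : Type*} [Ring A]

theorem mul_list_prod_of_anticomm [Algebra ℂ A] (a : A) (l : List A)
    (h : ∀ b ∈ l, a * b = -(b * a)) :
    a * l.prod = (-1 : ℂ) ^ l.length • (l.prod * a) := by
  induction l with
  | nil => simp
  | cons b l ih =>
    rw [List.prod_cons, ← mul_assoc, h b (by simp), neg_mul, mul_assoc,
      ih fun c hc => h c (by simp [hc]), List.length_cons, pow_succ, mul_smul_comm, mul_assoc]
    simp

theorem isIdempotentElem_list_prod (l : List A) (hl : ∀ a ∈ l, IsIdempotentElem a)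
    (hc : ∀ a ∈ l, ∀ b ∈ l, Commute a b) : IsIdempotentElem l.prod := by
  induction l with
  | nil => simp [IsIdempotentElem]
  | cons a l ih =>
    rw [List.prod_cons]
    refine IsIdempotentElem.mul_of_commute ?_ (hl a (by simp)) (ih ?_ ?_)
    · exact Commute.list_prod_right _ _ fun b hb => hc a (by simp) b (by simp [hb])
    · exact fun b hb => hl b (by simp [hb])
    · exact fun b hb c hb' => hc b (by simp [hb]) c (by simp [hb'])

/-- The value of a trace form on a product of consecutive vectors `v i`, where non-adjacent vectors
anticommute. -/
theorem traceForm_prod_consecutive [Algebra ℂ A] (t : A →ₗ[ℂ] ℂ) (ht : ∀ a b, t (a * b) = t (b * a))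
    (v : ℕ → A) (m : ℕ) (hadj : ∀ i, i + 1 < m → v i * v (i + 1) + v (i + 1) * v i = -2)
    (hfar : ∀ i j, i + 2 ≤ j → v i * v j = -(v j * v i)) (k i : ℕ) (hik : i + 2 * k ≤ m) :
    t ((List.range' i (2 * k)).map v).prod = (-1) ^ k * t 1 := by
  induction k generalizing i with
  | zero => simp
  | succ k ih =>
    have hR := ih (i + 2) (by omega)
    have hcomm := mul_list_prod_of_anticomm (v i) ((List.range' (i + 2) (2 * k)).map v) (by
      intro b hb
      obtain ⟨j, hj, rfl⟩ := List.mem_map.1 hb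
      exact hfar i j (List.mem_range'_1.1 hj).1)
    rw [show 2 * (k + 1) = 2 * k + 1 + 1 by ring, List.range'_succ, List.range'_succ]
    simp only [List.map_cons, List.prod_cons, add_assoc, Nat.reduceAdd]
    simp only [List.length_map, List.length_range', pow_mul, neg_one_sq, one_pow, one_smul] at hcomm
    set R := ((List.range' (i + 2) (2 * k)).map v).prod
    have h1 : v i * (v (i + 1) * R) = (-2 : ℂ) • R - v (i + 1) * (v i * R) := by
      have h := congrArg (· * R) (hadj i (by omega))
      simp only [add_mul, mul_assoc] at h
      rw [eq_sub_iff_add_eq, h, neg_smul, ofNat_smul_eq_nsmul ℂ 2 R]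
      simp [two_mul]
    have h2 : t (v i * (v (i + 1) * R)) = -2 * t R - t (v i * (v (i + 1) * R)) := by
      conv_lhs => rw [h1, hcomm]
      rw [map_sub, map_smul, smul_eq_mul, ht (v i), mul_assoc]
    rw [hR] at h2
    rw [pow_succ]
    linear_combination h2 / 2

/-- The idempotent `(1/2)(1 + √−1 x_{2i} x_{2i+1})` attached to a sequence `x`. -/
noncomputable def pairIdem [Algebra ℂ A] (x : ℕ → A) (i : ℕ) : A :=
  (2 : ℂ)⁻¹ • (1 + Complex.I • (x (2 * i) * x (2 * i + 1)))

theorem commute_mul_of_anticomm {x : ℕ → A}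
    (hx : ∀ i j, i ≠ j → x i * x j = -(x j * x i)) {i j l : ℕ} (hi : l ≠ i) (hj : l ≠ j) :
    Commute (x l) (x i * x j) := by
  rw [commute_iff_eq, ← mul_assoc, hx l i hi, neg_mul, mul_assoc, hx l j hj, mul_neg, neg_neg,
    mul_assoc]

theorem commute_pairIdem_of_ne [Algebra ℂ A] {x : ℕ → A}
    (hx : ∀ i j, i ≠ j → x i * x j = -(x j * x i)) {i l : ℕ} (h₀ : l ≠ 2 * i) (h₁ : l ≠ 2 * i + 1) :
    Commute (x l) (pairIdem x i) :=
  ((Commute.one_right _).add_right ((commute_mul_of_anticomm hx h₀ h₁).smul_right _)).smul_right _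

theorem commute_pairIdem [Algebra ℂ A] {x : ℕ → A}
    (hx : ∀ i j, i ≠ j → x i * x j = -(x j * x i)) (i j : ℕ) :
    Commute (pairIdem x i) (pairIdem x j) := by
  obtain rfl | hij := eq_or_ne i j
  · exact Commute.refl _
  · refine ((Commute.one_left _).add_left (Commute.smul_left ?_ _)).smul_left _
    exact (commute_pairIdem_of_ne hx (by omega) (by omega)).mul_left
      (commute_pairIdem_of_ne hx (by omega) (by omega))

theorem isIdempotentElem_pairIdem [Algebra ℂ A] {x : ℕ → A}
    (hx : ∀ i j, i ≠ j → x i * x j = -(x j * x i)) {i : ℕ} (h₀ : x (2 * i) * x (2 * i) = 1)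
    (h₁ : x (2 * i + 1) * x (2 * i + 1) = 1) : IsIdempotentElem (pairIdem x i) := by
  have hsq : (x (2 * i) * x (2 * i + 1)) * (x (2 * i) * x (2 * i + 1)) = -1 := by
    rw [mul_assoc, ← mul_assoc (x (2 * i + 1)), hx (2 * i + 1) (2 * i) (by omega), neg_mul,
      mul_neg, mul_assoc (x (2 * i)), h₁, mul_one, h₀]
  unfold IsIdempotentElem pairIdem
  rw [smul_mul_smul_comm, add_mul, mul_add, mul_add, smul_mul_smul_comm, hsq, Complex.I_mul_I]
  simp only [one_mul, mul_one]
  module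

theorem traceForm_prod_pairIdem [Algebra ℂ A] {x : ℕ → A}
    (hx : ∀ i j, i ≠ j → x i * x j = -(x j * x i)) (s : A →ₗ[ℂ] ℂ)
    (hs : ∀ a b, s (a * b) = s (b * a)) (k i : ℕ) :
    s ((List.range' i k).map (pairIdem x)).prod = (2⁻¹) ^ k * s 1 := by
  induction k generalizing i with
  | zero => simp
  | succ k ih =>
    have hR := ih (i + 1)
    have hcomm : Commute (x (2 * i)) ((List.range' (i + 1) k).map (pairIdem x)).prod := by
      refine Commute.list_prod_right _ _ fun b hb => ?_
      obtain ⟨j, hj, rfl⟩ := List.mem_map.1 hb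
      have := (List.mem_range'_1.1 hj).1
      exact commute_pairIdem_of_ne hx (by omega) (by omega)
    rw [List.range'_succ, List.map_cons, List.prod_cons]
    set R := ((List.range' (i + 1) k).map (pairIdem x)).prod
    have h : s (x (2 * i) * x (2 * i + 1) * R) = -s (x (2 * i) * x (2 * i + 1) * R) := by
      conv_lhs => rw [mul_assoc, hs, mul_assoc, ← hcomm.eq, ← mul_assoc,
        hx (2 * i + 1) (2 * i) (by omega), neg_mul, map_neg]
    have h0 := self_eq_neg.1 h
    rw [pairIdem, smul_mul_assoc, add_mul, one_mul, smul_mul_assoc, map_smul, map_add, map_smul,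
      h0, hR, smul_zero, add_zero, smul_eq_mul, pow_succ]
    ring

end TraceForms

/-- The generators of `𝒞ₙ` as a sequence, extended by zero. -/
noncomputable def ξSeq (n i : ℕ) : Cl n := if h : i < n then ξ n ⟨i, h⟩ else 0

theorem ξSeq_mul_self {n i : ℕ} (h : i < n) : ξSeq n i * ξSeq n i = 1 := by
  rw [ξSeq, dif_pos h, ξ, ι_sq_scalar]
  have h1 : Qf n (Pi.single ⟨i, h⟩ 1) = 1 := by
    simp [Qf, QuadraticMap.weightedSumSquares_apply, Pi.single_apply]
  rw [h1, map_one]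

theorem ξSeq_anticomm (n i j : ℕ) (hij : i ≠ j) :
    ξSeq n i * ξSeq n j = -(ξSeq n j * ξSeq n i) := by
  unfold ξSeq
  split_ifs with hi hj
  · refine ι_mul_ι_comm_of_isOrtho ?_
    have hne : (⟨i, hi⟩ : Fin n) ≠ ⟨j, hj⟩ := by simpa using hij
    rw [QuadraticMap.isOrtho_def]
    simp only [Qf, QuadraticMap.weightedSumSquares_apply, ← Finset.sum_add_distrib]
    refine Finset.sum_congr rfl fun k _ => ?_
    by_cases hk : k = ⟨i, hi⟩
    · subst hk; simp [hne]
    · simp [Pi.single_apply, hk]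
  all_goals simp

theorem eIdem_eq (n : ℕ) : eIdem n = ((List.range' 0 (n / 2)).map (pairIdem (ξSeq n))).prod := by
  rw [← List.range_eq_range', ← List.map_coe_finRange_eq_range, List.map_map, eIdem]
  congr 1
  refine List.map_congr_left fun i _ => ?_
  have := i.isLt
  simp only [Function.comp, pairIdem, ξSeq]
  rw [dif_pos (by omega), dif_pos (by omega)]

theorem Pelt_eq (n : ℕ) :
    Pelt n = ((List.range' 0 (n - 1)).map fun i => ξSeq n i - ξSeq n (i + 1)).prod := by
  rw [← List.range_eq_range', ← List.map_coe_finRange_eq_range, List.map_map, Pelt]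
  congr 1
  refine List.map_congr_left fun i _ => ?_
  have := i.isLt
  simp only [Function.comp, ξSeq]
  rw [dif_pos (by omega), dif_pos (by omega)]

theorem isIdempotentElem_eIdem (n : ℕ) : IsIdempotentElem (eIdem n) := by
  rw [eIdem_eq]
  refine isIdempotentElem_list_prod _ ?_ ?_
  · intro a ha
    obtain ⟨i, hi, rfl⟩ := List.mem_map.1 ha
    have := (List.mem_range'_1.1 hi).2
    exact isIdempotentElem_pairIdem (ξSeq_anticomm n) (ξSeq_mul_self (by omega))
      (ξSeq_mul_self (by omega))
  · intro a ha b hb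
    obtain ⟨i, -, rfl⟩ := List.mem_map.1 ha
    obtain ⟨j, -, rfl⟩ := List.mem_map.1 hb
    exact commute_pairIdem (ξSeq_anticomm n) i j

/-- The basis of `𝒞ₙ` indexed by subsets of the index set. -/
noncomputable def basisCl (n : ℕ) : Module.Basis (Finset (Fin n)) ℂ (Cl n) :=
  (Module.Basis.ExteriorAlgebra (Pi.basisFun ℂ (Fin n))).map (equivExterior (Qf n)).symm

instance finite_Cl (n : ℕ) : Module.Finite ℂ (Cl n) := Module.Finite.of_basis (basisCl n)

theorem finrank_Cl (n : ℕ) : Module.finrank ℂ (Cl n) = 2 ^ n := by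
  simp [Module.finrank_eq_card_basis (basisCl n)]

theorem finrank_Ln (n : ℕ) : (Module.finrank ℂ (Ln n) : ℂ) = (2⁻¹) ^ (n / 2) * 2 ^ n := by
  have hproj : LinearMap.IsProj (Ln n) (LinearMap.mulRight ℂ (eIdem n)) := by
    refine ⟨fun y => ⟨y, rfl⟩, ?_⟩
    rintro _ ⟨y, rfl⟩
    simp [mul_assoc, (isIdempotentElem_eIdem n).eq]
  have h := traceForm_prod_pairIdem (ξSeq_anticomm n)
    (LinearMap.trace ℂ (Cl n) ∘ₗ (LinearMap.mul ℂ (Cl n)).flip) (fun a b => by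
      have hmul (a b : Cl n) : (LinearMap.mul ℂ (Cl n)).flip (a * b) =
          (LinearMap.mul ℂ (Cl n)).flip b * (LinearMap.mul ℂ (Cl n)).flip a := by
        ext1 y
        simp [mul_assoc]
      rw [LinearMap.comp_apply, LinearMap.comp_apply, hmul, hmul, LinearMap.trace_mul_comm])
    (n / 2) 0
  rw [← eIdem_eq] at h
  have hone : (LinearMap.mul ℂ (Cl n)).flip 1 = LinearMap.id := by ext1 y; simp
  rw [← hproj.trace]
  refine h.trans ?_
  rw [LinearMap.comp_apply, hone, LinearMap.trace_id, finrank_Cl]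
  push_cast
  rfl

@[simp]
theorem coe_lmulLn_apply (n : ℕ) (P : Cl n) (y : Ln n) : (lmulLn n P y : Cl n) = P * y := rfl

theorem lmulLn_mul (n : ℕ) (a b : Cl n) : lmulLn n (a * b) = lmulLn n a * lmulLn n b := by
  ext y
  simp [mul_assoc]

theorem lmulLn_one (n : ℕ) : lmulLn n 1 = LinearMap.id := by
  ext y
  simp

/-- The representation of `𝒞ₙ` on `Lₙ`, as a linear map. -/
noncomputable def lmulLnLinear (n : ℕ) : Cl n →ₗ[ℂ] Module.End ℂ (Ln n) where
  toFun := lmulLn n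
  map_add' a b := by ext y; simp [add_mul]
  map_smul' c a := by ext y; simp

@[simp]
theorem lmulLnLinear_apply (n : ℕ) (P : Cl n) : lmulLnLinear n P = lmulLn n P := rfl

theorem ξSeq_sub_adjacent {n i : ℕ} (hi : i + 2 < n) :
    (ξSeq n i - ξSeq n (i + 1)) * (ξSeq n (i + 1) - ξSeq n (i + 1 + 1)) +
      (ξSeq n (i + 1) - ξSeq n (i + 1 + 1)) * (ξSeq n i - ξSeq n (i + 1)) = -2 := by
  simp only [sub_mul, mul_sub, ξSeq_mul_self (show i + 1 < n by omega),
    ξSeq_anticomm n (i + 1) i (by omega), ξSeq_anticomm n (i + 1 + 1) i (by omega),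
    ξSeq_anticomm n (i + 1 + 1) (i + 1) (by omega)]
  rw [← one_add_one_eq_two]
  abel

theorem ξSeq_sub_anticomm (n : ℕ) {i j : ℕ} (hij : i + 2 ≤ j) :
    (ξSeq n i - ξSeq n (i + 1)) * (ξSeq n j - ξSeq n (j + 1)) =
      -((ξSeq n j - ξSeq n (j + 1)) * (ξSeq n i - ξSeq n (i + 1))) := by
  simp only [sub_mul, mul_sub, ξSeq_anticomm n j i (by omega),
    ξSeq_anticomm n (j + 1) i (by omega), ξSeq_anticomm n j (i + 1) (by omega),
    ξSeq_anticomm n (j + 1) (i + 1) (by omega)]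
  abel

/-- for odd `n`, the trace on `Lₙ = 𝒞ₙ·e` of left multiplication
by `P = (ξ₁ − ξ₂) ⋯ (ξ_{n−1} − ξₙ)` is `(−1)^((n−1)/2) · 2^((n+1)/2)`. -/
theorem trace_lmul_Pelt (n : ℕ) (hn : 1 ≤ n) (hodd : Odd n) :
    LinearMap.trace ℂ (Ln n) (lmulLn n (Pelt n)) =
      (-1 : ℂ) ^ ((n - 1) / 2) * 2 ^ ((n + 1) / 2) := by
  obtain ⟨r, rfl⟩ := hodd
  have h := traceForm_prod_consecutive
    (LinearMap.trace ℂ (Ln (2 * r + 1)) ∘ₗ lmulLnLinear (2 * r + 1))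
    (fun a b => by
      simp only [LinearMap.comp_apply, lmulLnLinear_apply, lmulLn_mul]
      exact LinearMap.trace_mul_comm ℂ _ _)
    (fun i => ξSeq (2 * r + 1) i - ξSeq (2 * r + 1) (i + 1)) (2 * r)
    (fun i hi => ξSeq_sub_adjacent (by omega)) (fun i j hij => ξSeq_sub_anticomm _ hij)
    r 0 (by omega)
  rw [LinearMap.comp_apply, LinearMap.comp_apply, lmulLnLinear_apply, lmulLnLinear_apply,
    lmulLn_one, LinearMap.trace_id, finrank_Ln, show (2 * r + 1) / 2 = r by omega] at h
  rw [Pelt_eq, show (2 * r + 1 - 1) / 2 = r by omega, show (2 * r + 1 + 1) / 2 = r + 1 by omega]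
  refine h.trans ?_
  rw [inv_pow, show 2 * r + 1 = r + (r + 1) by ring, pow_add, inv_mul_cancel_left₀ (by simp)]

end CliffordSpin
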